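/- A pair (I₀, J₀) ∈ ℚ × ℚ occurs as the pair of invariants (I(f), J(f)) of some integral ternary cubic form f if and only if all of the following hold: (1) 16I₀ and 32J₀ are integers; (2) the pair of integers (16I₀, 32J₀) satisfies one of the following: [16I₀ ≡ 0 (mod 16) and 32J₀ ≡ 0 (mod 32)], [16I₀ ≡ 0 (mod 16) and 32J₀ ≡ 8 (mod 32)], [16I₀ ≡ 1 (mod 64) and 32J₀ ≡ 31 (mod 32)], [16I₀ ≡ 9 (mod 64) and 32J₀ ≡ 27 (mod 32)], [16I₀ ≡ 17 (mod 64) and 32J₀ ≡ 7 (mod 32)], [16I₀ ≡ 25 (mod 64) and 32J₀ ≡ 3 (mod 32)], [16I₀ ≡ 33 (mod 64) and 32J₀ ≡ 15 (mod 32)], [16I₀ ≡ 41 (mod 64) and 32J₀ ≡ 11 (mod 32)], [16I₀ ≡ 49 (mod 64) and 32J₀ ≡ 23 (mod 32)], or [16I₀ ≡ 57 (mod 64) and 32J₀ ≡ 19 (mod 32)]; and (3) the pair (I₀, J₀) satisfies one of the following congruences (interpreted via the integers 16I₀ and 32J₀, since 16 and 32 are invertible modulo 27: I₀ ≡ c (mod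 3^k) means 16I₀ ≡ 16c (mod 3^k), and J₀ ≡ c (mod 3^k) means 32J₀ ≡ 32c (mod 3^k)): [I₀ ≡ 0 (mod 3) and J₀ ≡ 0 (mod 27)], [I₀ ≡ 1 (mod 9) and J₀ ≡ ±2 (mod 27)], [I₀ ≡ 4 (mod 9) and J₀ ≡ ±16 (mod 27)], or [I₀ ≡ 7 (mod 9) and J₀ ≡ ±7 (mod 27)]. -/

import Mathlib

open MvPolynomial

/-- The action of a 3×3 matrix on ternary forms: `(γ·f)(x,y,z) = f((x,y,z)·γ)`. -/
noncomputable def actGL {R : Type*} [CommRing R] (γ : Matrix (Fin 3) (Fin 3) R)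
    (f : MvPolynomial (Fin 3) R) : MvPolynomial (Fin 3) R :=
  bind₁ (fun j => ∑ i : Fin 3, C (γ i j) * X i) f

/-- The Hessian of a ternary form: the determinant of the matrix of second partials. -/
noncomputable def hess {R : Type*} [CommRing R] (f : MvPolynomial (Fin 3) R) :
    MvPolynomial (Fin 3) R :=
  Matrix.det (Matrix.of fun i j => pderiv i (pderiv j f))

/-- The exponent vectors of the ten monomials of a ternary cubic form. -/
def expo : Fin 10 → Fin 3 → ℕ :=
  ![![3,0,0], ![0,3,0], ![0,0,3], ![2,1,0], ![2,0,1],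
    ![1,2,0], ![0,2,1], ![1,0,2], ![0,1,2], ![1,1,1]]

/-- The ternary cubic form with coefficient vector `c : Fin 10 → R`. -/
noncomputable def cubic {R : Type*} [CommRing R] (c : Fin 10 → R) : MvPolynomial (Fin 3) R :=
  ∑ k : Fin 10, C (c k) * ∏ i : Fin 3, X i ^ expo k i

/-- The coefficient vector of the Weierstrass cubic `x³ + A·x·z² + B·z³ − y²·z`. -/
noncomputable def wcoeffs {R : Type*} [CommRing R] (A B : R) : Fin 10 → R :=
  ![1, 0, B, 0, 0, 0, -1, A, 0, 0]

/-- The generic ternary cubic form, whose coefficients are the 10 indeterminates. -/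
noncomputable def genCubic (R : Type*) [CommRing R] :
    MvPolynomial (Fin 3) (MvPolynomial (Fin 10) R) :=
  cubic (fun k => X k)

/-- `P` and `Q` are the invariants `I` and `J`: they are homogeneous of degrees 4 and 6
in the ten coefficients, they satisfy the identity
`H(H(f)) = 12288·I(f)²·f + 512·J(f)·H(f)` (stated for the generic ternary cubic form,
hence for every ternary cubic form over every commutative `R`-algebra), and they are
normalized so that `x³ + A·x·z² + B·z³ − y²·z` has `I = −3A` and `J = −27B`. -/
def IsInvariantPair (R : Type*) [CommRing R] (P Q : MvPolynomial (Fin 10) R) : Prop :=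
  P.IsHomogeneous 4 ∧ Q.IsHomogeneous 6 ∧
  hess (hess (genCubic R)) =
    12288 * C P ^ 2 * genCubic R + 512 * C Q * hess (genCubic R) ∧
  ∀ A B : R, aeval (wcoeffs A B) P = -3 * A ∧ aeval (wcoeffs A B) Q = -27 * B

/-- `(I₀, J₀)` occurs as the pair of invariants of some integral ternary cubic form. -/
def Eligible (P Q : MvPolynomial (Fin 10) ℚ) (I₀ J₀ : ℚ) : Prop :=
  ∃ c : Fin 10 → ℤ, aeval (fun k => ((c k : ℚ))) P = I₀ ∧ aeval (fun k => ((c k : ℚ))) Q = J₀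

/-! ### Covariants of a ternary cubic, in coordinates -/

/-- Weierstrass coefficient `a₁` of the Jacobian of the ternary cubic `c`. -/
def jac_a1 {R : Type*} [CommRing R] (c : Fin 10 → R) : R :=
    c 9

/-- Weierstrass coefficient `a₂`. -/
def jac_a2 {R : Type*} [CommRing R] (c : Fin 10 → R) : R :=
    -c 3 * c 8 - c 4 * c 6 - c 5 * c 7

/-- Weierstrass coefficient `a₃`. -/
def jac_a3 {R : Type*} [CommRing R] (c : Fin 10 → R) : R :=
    9 * c 0 * c 1 * c 2 - c 0 * c 6 * c 8 - c 1 * c 4 * c 7 - c 2 * c 3 * c 5 - c 3 * c 6 * c 7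
      - c 4 * c 5 * c 8

/-- Weierstrass coefficient `a₄`. -/
def jac_a4 {R : Type*} [CommRing R] (c : Fin 10 → R) : R :=
    -3 * c 0 * c 1 * c 7 * c 8 - 3 * c 0 * c 2 * c 5 * c 6 + c 0 * c 5 * c 8^2
      + c 0 * c 6^2 * c 7 - 3 * c 1 * c 2 * c 3 * c 4 + c 1 * c 3 * c 7^2 + c 1 * c 4^2 * c 8
      + c 2 * c 3^2 * c 6 + c 2 * c 4 * c 5^2 + c 3 * c 4 * c 6 * c 8 + c 3 * c 5 * c 7 * c 8
      + c 4 * c 5 * c 6 * c 7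

/-- Weierstrass coefficient `a₆`. -/
def jac_a6 {R : Type*} [CommRing R] (c : Fin 10 → R) : R :=
    -27 * c 0^2 * c 1^2 * c 2^2 + 9 * c 0^2 * c 1 * c 2 * c 6 * c 8 - c 0^2 * c 1 * c 8^3
      - c 0^2 * c 2 * c 6^3 + 9 * c 0 * c 1^2 * c 2 * c 4 * c 7 - c 0 * c 1^2 * c 7^3
      + 9 * c 0 * c 1 * c 2^2 * c 3 * c 5 + 3 * c 0 * c 1 * c 2 * c 3 * c 6 * c 7
      - 3 * c 0 * c 1 * c 2 * c 3 * c 8 * c 9 + 3 * c 0 * c 1 * c 2 * c 4 * c 5 * c 8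
      - 3 * c 0 * c 1 * c 2 * c 4 * c 6 * c 9 - 3 * c 0 * c 1 * c 2 * c 5 * c 7 * c 9
      + c 0 * c 1 * c 2 * c 9^3 + 2 * c 0 * c 1 * c 3 * c 7 * c 8^2
      - c 0 * c 1 * c 4 * c 6 * c 7 * c 8 + c 0 * c 1 * c 4 * c 8^2 * c 9
      + 2 * c 0 * c 1 * c 5 * c 7^2 * c 8 + c 0 * c 1 * c 6 * c 7^2 * c 9
      - c 0 * c 1 * c 7 * c 8 * c 9^2 - c 0 * c 2^2 * c 5^3 - c 0 * c 2 * c 3 * c 5 * c 6 * c 8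
      + c 0 * c 2 * c 3 * c 6^2 * c 9 + 2 * c 0 * c 2 * c 4 * c 5 * c 6^2
      + 2 * c 0 * c 2 * c 5^2 * c 6 * c 7 + c 0 * c 2 * c 5^2 * c 8 * c 9
      - c 0 * c 2 * c 5 * c 6 * c 9^2 - c 0 * c 3 * c 6^2 * c 7 * c 8
      - c 0 * c 4 * c 5 * c 6 * c 8^2 - c 0 * c 5^2 * c 7 * c 8^2 - c 0 * c 5 * c 6^2 * c 7^2
      + c 0 * c 5 * c 6 * c 7 * c 8 * c 9 - c 1^2 * c 2 * c 4^3 - c 1 * c 2^2 * c 3^3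
      + 2 * c 1 * c 2 * c 3^2 * c 4 * c 8 + c 1 * c 2 * c 3^2 * c 7 * c 9
      + 2 * c 1 * c 2 * c 3 * c 4^2 * c 6 - c 1 * c 2 * c 3 * c 4 * c 5 * c 7
      - c 1 * c 2 * c 3 * c 4 * c 9^2 + c 1 * c 2 * c 4^2 * c 5 * c 9
      - c 1 * c 3^2 * c 7^2 * c 8 - c 1 * c 3 * c 4^2 * c 8^2 - c 1 * c 3 * c 4 * c 6 * c 7^2
      + c 1 * c 3 * c 4 * c 7 * c 8 * c 9 - c 1 * c 4^2 * c 5 * c 7 * c 8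
      - c 2 * c 3^2 * c 4 * c 6^2 - c 2 * c 3^2 * c 5 * c 6 * c 7
      - c 2 * c 3 * c 4 * c 5^2 * c 8 + c 2 * c 3 * c 4 * c 5 * c 6 * c 9
      - c 2 * c 4^2 * c 5^2 * c 6 - c 3 * c 4 * c 5 * c 6 * c 7 * c 8

/-- `c₄` of a Weierstrass equation. -/
def wc4 {R : Type*} [CommRing R] (a1 a2 a3 a4 : R) : R :=
  (a1 ^ 2 + 4 * a2) ^ 2 - 24 * (a1 * a3 + 2 * a4)

/-- `c₆` of a Weierstrass equation. -/
def wc6 {R : Type*} [CommRing R] (a1 a2 a3 a4 a6 : R) : R :=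
  -(a1 ^ 2 + 4 * a2) ^ 3 + 36 * (a1 ^ 2 + 4 * a2) * (a1 * a3 + 2 * a4) - 216 * (a3 ^ 2 + 4 * a6)

/-- The invariant `c₄ = 16 I`. -/
def cub4 {R : Type*} [CommRing R] (c : Fin 10 → R) : R :=
  wc4 (jac_a1 c) (jac_a2 c) (jac_a3 c) (jac_a4 c)

/-- The invariant `c₆ = 32 J`. -/
def cub6 {R : Type*} [CommRing R] (c : Fin 10 → R) : R :=
  wc6 (jac_a1 c) (jac_a2 c) (jac_a3 c) (jac_a4 c) (jac_a6 c)

/-- The coefficients of the Hessian of the cubic with coefficients `c`. -/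
def hc {R : Type*} [CommRing R] (c : Fin 10 → R) : Fin 10 → R :=
  ![
    24 * c 0 * c 5 * c 7 - 6 * c 0 * c 9^2 - 8 * c 3^2 * c 7 + 8 * c 3 * c 4 * c 9
      - 8 * c 4^2 * c 5,
    24 * c 1 * c 3 * c 8 - 6 * c 1 * c 9^2 - 8 * c 3 * c 6^2 - 8 * c 5^2 * c 8
      + 8 * c 5 * c 6 * c 9,
    24 * c 2 * c 4 * c 6 - 6 * c 2 * c 9^2 - 8 * c 4 * c 8^2 - 8 * c 6 * c 7^2
      + 8 * c 7 * c 8 * c 9,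
    72 * c 0 * c 1 * c 7 + 24 * c 0 * c 5 * c 8 - 24 * c 0 * c 6 * c 9 - 24 * c 1 * c 4^2
      - 8 * c 3^2 * c 8 + 16 * c 3 * c 4 * c 6 - 8 * c 3 * c 5 * c 7 + 2 * c 3 * c 9^2,
    72 * c 0 * c 2 * c 5 + 24 * c 0 * c 6 * c 7 - 24 * c 0 * c 8 * c 9 - 24 * c 2 * c 3^2
      + 16 * c 3 * c 4 * c 8 - 8 * c 4^2 * c 6 - 8 * c 4 * c 5 * c 7 + 2 * c 4 * c 9^2,
    72 * c 0 * c 1 * c 8 - 24 * c 0 * c 6^2 + 24 * c 1 * c 3 * c 7 - 24 * c 1 * c 4 * c 9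
      - 8 * c 3 * c 5 * c 8 + 16 * c 4 * c 5 * c 6 - 8 * c 5^2 * c 7 + 2 * c 5 * c 9^2,
    72 * c 1 * c 2 * c 3 + 24 * c 1 * c 4 * c 8 - 24 * c 1 * c 7 * c 9 - 24 * c 2 * c 5^2
      - 8 * c 3 * c 6 * c 8 - 8 * c 4 * c 6^2 + 16 * c 5 * c 6 * c 7 + 2 * c 6 * c 9^2,
    72 * c 0 * c 2 * c 6 - 24 * c 0 * c 8^2 - 24 * c 2 * c 3 * c 9 + 24 * c 2 * c 4 * c 5
      + 16 * c 3 * c 7 * c 8 - 8 * c 4 * c 6 * c 7 - 8 * c 5 * c 7^2 + 2 * c 7 * c 9^2,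
    72 * c 1 * c 2 * c 4 - 24 * c 1 * c 7^2 + 24 * c 2 * c 3 * c 6 - 24 * c 2 * c 5 * c 9
      - 8 * c 3 * c 8^2 - 8 * c 4 * c 6 * c 8 + 16 * c 5 * c 7 * c 8 + 2 * c 8 * c 9^2,
    216 * c 0 * c 1 * c 2 - 24 * c 0 * c 6 * c 8 - 24 * c 1 * c 4 * c 7 - 24 * c 2 * c 3 * c 5
      + 24 * c 3 * c 6 * c 7 - 8 * c 3 * c 8 * c 9 + 24 * c 4 * c 5 * c 8 - 8 * c 4 * c 6 * c 9
      - 8 * c 5 * c 7 * c 9 + 2 * c 9^3]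

set_option maxRecDepth 10000 in
set_option maxHeartbeats 4000000 in
theorem hess_cubic {R : Type*} [CommRing R] (c : Fin 10 → R) :
    hess (cubic c) = cubic (hc c) := by
  have p2 : ∀ i, pderiv i (2 : MvPolynomial (Fin 3) R) = 0 := fun i =>
    (pderiv i).map_natCast 2
  have p3 : ∀ i, pderiv i (3 : MvPolynomial (Fin 3) R) = 0 := fun i =>
    (pderiv i).map_natCast 3
  unfold hess
  rw [Matrix.det_fin_three]
  simp only [cubic, hc, expo, Fin.sum_univ_succ, Fin.prod_univ_succ, Matrix.of_apply, map_add,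
    Derivation.leibniz, pderiv_C, pderiv_X, Derivation.leibniz_pow]
  simp [Fin.ext_iff, map_ofNat, p2, p3]
  ring

theorem hc_hc_zero {R : Type*} [CommRing R] (c : Fin 10 → R) :
    hc (hc c) 0 = 48 * cub4 c ^ 2 * c 0 + 16 * cub6 c * hc c 0 := by
  simp only [hc, cub4, cub6, wc4, wc6, jac_a1, jac_a2, jac_a3, jac_a4, jac_a6]
  simp
  ring

/-- Exchange of the variables `x` and `y` on coefficient vectors. -/
def swapc {R : Type*} (c : Fin 10 → R) : Fin 10 → R :=
  ![c 1, c 0, c 2, c 5, c 6, c 3, c 4, c 8, c 7, c 9]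

theorem hc_swap {R : Type*} [CommRing R] (c : Fin 10 → R) : hc (swapc c) = swapc (hc c) := by
  funext i
  fin_cases i <;> simp [hc, swapc] <;> ring

theorem cub4_swap {R : Type*} [CommRing R] (c : Fin 10 → R) : cub4 (swapc c) = cub4 c := by
  simp [cub4, wc4, jac_a1, jac_a2, jac_a3, jac_a4, swapc]
  ring

theorem cub6_swap {R : Type*} [CommRing R] (c : Fin 10 → R) : cub6 (swapc c) = cub6 c := by
  simp [cub6, wc6, jac_a1, jac_a2, jac_a3, jac_a4, jac_a6, swapc]
  ring

theorem hc_hc_one {R : Type*} [CommRing R] (c : Fin 10 → R) :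
    hc (hc c) 1 = 48 * cub4 c ^ 2 * c 1 + 16 * cub6 c * hc c 1 := by
  have h := hc_hc_zero (swapc c)
  rw [hc_swap, hc_swap, cub4_swap, cub6_swap] at h
  exact h

theorem eval_cubic_zero {R : Type*} [CommRing R] (c : Fin 10 → R) :
    eval ![1, 0, 0] (cubic c) = c 0 := by
  simp [cubic, expo, Fin.sum_univ_succ, Fin.prod_univ_succ]

theorem eval_cubic_one {R : Type*} [CommRing R] (c : Fin 10 → R) :
    eval ![0, 1, 0] (cubic c) = c 1 := by
  simp [cubic, expo, Fin.sum_univ_succ, Fin.prod_univ_succ]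

theorem map_cub4 {R S : Type*} [CommRing R] [CommRing S] (φ : R →+* S) (c : Fin 10 → R) :
    φ (cub4 c) = cub4 (fun k => φ (c k)) := by
  simp [cub4, wc4, jac_a1, jac_a2, jac_a3, jac_a4, map_ofNat]

theorem map_cub6 {R S : Type*} [CommRing R] [CommRing S] (φ : R →+* S) (c : Fin 10 → R) :
    φ (cub6 c) = cub6 (fun k => φ (c k)) := by
  simp [cub6, wc6, jac_a1, jac_a2, jac_a3, jac_a4, jac_a6, map_ofNat]

theorem map_hc {R S : Type*} [CommRing R] [CommRing S] (φ : R →+* S) (c : Fin 10 → R)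
    (i : Fin 10) : φ (hc c i) = hc (fun k => φ (c k)) i := by
  fin_cases i <;> simp [hc, map_ofNat]

/-- The invariants are `c₄ / 16` and `c₆ / 32`. -/
theorem invariants_eq (P Q : MvPolynomial (Fin 10) ℚ) (hPQ : IsInvariantPair ℚ P Q) :
    16 * P = cub4 X ∧ 32 * Q = cub6 X := by
  obtain ⟨-, -, hid, hw⟩ := hPQ
  have hX : genCubic ℚ = cubic (X : Fin 10 → MvPolynomial (Fin 10) ℚ) := rfl
  rw [hX, hess_cubic, hess_cubic] at hid
  have e0 := congrArg (eval ![1, 0, 0]) hid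
  have e1 := congrArg (eval ![0, 1, 0]) hid
  simp only [map_add, map_mul, map_pow, eval_cubic_zero, eval_C, map_ofNat] at e0
  simp only [map_add, map_mul, map_pow, eval_cubic_one, eval_C, map_ofNat] at e1
  rw [hc_hc_zero] at e0
  rw [hc_hc_one] at e1
  have hD : hc (X : Fin 10 → MvPolynomial (Fin 10) ℚ) 0 * X 1 - hc X 1 * X 0 ≠ 0 := by
    intro h
    have := congrArg (eval (![1, 1, 0, 0, 0, 1, 0, 1, 0, 0] : Fin 10 → ℚ)) h
    simp only [map_sub, map_mul, map_hc, eval_X, map_zero] at this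
    simp [hc] at this
  have h6 : 32 * Q = cub6 X := by
    have : (32 * Q - cub6 X) *
        (hc (X : Fin 10 → MvPolynomial (Fin 10) ℚ) 0 * X 1 - hc X 1 * X 0) * 16 = 0 := by
      linear_combination (-(X 1 : MvPolynomial (Fin 10) ℚ)) * e0 + X 0 * e1
    have h16 : (16 : MvPolynomial (Fin 10) ℚ) ≠ 0 := by norm_num
    have := (mul_eq_zero.mp ((mul_eq_zero.mp this).resolve_right h16)).resolve_right hD
    exact sub_eq_zero.mp this
  refine ⟨?_, h6⟩
  have h4 : (16 * P - cub4 X) * (16 * P + cub4 X) * (48 * X 0) = 0 := by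
    linear_combination -e0 - 16 * hc X 0 * h6
  have h48 : (48 * X 0 : MvPolynomial (Fin 10) ℚ) ≠ 0 :=
    mul_ne_zero (by norm_num) (X_ne_zero 0)
  rcases mul_eq_zero.mp ((mul_eq_zero.mp h4).resolve_right h48) with h | h
  · exact sub_eq_zero.mp h
  · exfalso
    have h1 := (hw 1 0).1
    have h2 := congrArg (eval (wcoeffs (1 : ℚ) 0)) h
    simp only [map_add, map_mul, map_ofNat, map_cub4, eval_X, map_zero] at h2
    rw [MvPolynomial.aeval_eq_eval] at h1
    change eval (wcoeffs (1 : ℚ) 0) P = _ at h1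
    rw [h1] at h2
    simp [cub4, wc4, jac_a1, jac_a2, jac_a3, jac_a4, wcoeffs] at h2
    norm_num at h2

/-- Values of the invariants at integer points. -/
theorem invariants_eval (P Q : MvPolynomial (Fin 10) ℚ) (hPQ : IsInvariantPair ℚ P Q)
    (c : Fin 10 → ℤ) :
    16 * aeval (fun k => ((c k : ℚ))) P = ((cub4 c : ℤ) : ℚ) ∧
      32 * aeval (fun k => ((c k : ℚ))) Q = ((cub6 c : ℤ) : ℚ) := by
  obtain ⟨h4, h6⟩ := invariants_eq P Q hPQ
  have e4 := congrArg (eval (fun k => ((c k : ℚ)))) h4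
  have e6 := congrArg (eval (fun k => ((c k : ℚ)))) h6
  simp only [map_mul, map_ofNat, map_cub4, map_cub6, eval_X] at e4 e6
  have i4 := map_cub4 (Int.castRingHom ℚ) c
  have i6 := map_cub6 (Int.castRingHom ℚ) c
  simp only [eq_intCast] at i4 i6
  rw [i4, i6, ← e4, ← e6]
  exact ⟨rfl, rfl⟩

theorem wc_rel (a1 a2 a3 a4 a6 : ℤ) :
    ∃ d : ℤ, wc4 a1 a2 a3 a4 ^ 3 - wc6 a1 a2 a3 a4 a6 ^ 2 = 1728 * d := by
  refine ⟨-(a1 ^ 2 + 4 * a2) ^ 2 * (a1 ^ 2 * a6 + 4 * a2 * a6 - a1 * a3 * a4 + a2 * a3 ^ 2 - a4 ^ 2)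
    - 8 * (a1 * a3 + 2 * a4) ^ 3 - 27 * (a3 ^ 2 + 4 * a6) ^ 2
    + 9 * (a1 ^ 2 + 4 * a2) * (a1 * a3 + 2 * a4) * (a3 ^ 2 + 4 * a6), ?_⟩
  unfold wc4 wc6
  ring

/-- A cubic with prescribed Weierstrass invariants. -/
theorem exists_cubic (a1 a2 a3 a4 a6 : ℤ) :
    ∃ c : Fin 10 → ℤ, cub4 c = wc4 a1 a2 a3 a4 ∧ cub6 c = wc6 a1 a2 a3 a4 a6 := by
  refine ⟨![-1, 0, -a6, 0, -a2, 0, 1, -a4, a3, a1], ?_, ?_⟩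
  · simp [cub4, wc4, jac_a1, jac_a2, jac_a3, jac_a4]
  · simp [cub6, wc6, jac_a1, jac_a2, jac_a3, jac_a4, jac_a6]

theorem two_odd : ∀ x y : ZMod 64, x ^ 3 = y ^ 2 → y.val % 4 = 3 →
    (x = 1 ∧ y.val % 32 = 31 ∨ x = 9 ∧ y.val % 32 = 27 ∨ x = 17 ∧ y.val % 32 = 7 ∨
     x = 25 ∧ y.val % 32 = 3 ∨ x = 33 ∧ y.val % 32 = 15 ∨ x = 41 ∧ y.val % 32 = 11 ∨
     x = 49 ∧ y.val % 32 = 23 ∨ x = 57 ∧ y.val % 32 = 19) := by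
  decide +kernel

set_option synthInstance.maxHeartbeats 400000 in
set_option synthInstance.maxSize 1000 in
theorem three_unit : ∀ x y : ZMod 27, x ^ 3 = y ^ 2 → ¬ x.val % 3 = 0 →
    (x.val % 9 = 7 ∧ (y.val = 10 ∨ y.val = 17) ∨ x.val % 9 = 1 ∧ (y.val = 26 ∨ y.val = 1) ∨
     x.val % 9 = 4 ∧ (y.val = 8 ∨ y.val = 19)) := by
  decide +kernel

set_option maxHeartbeats 4000000 in
/-- The construction of Kraus. -/
theorem kraus (a b : ℤ)
    (h2 : a ≡ 0 [ZMOD 16] ∧ b ≡ 0 [ZMOD 32] ∨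
         a ≡ 0 [ZMOD 16] ∧ b ≡ 8 [ZMOD 32] ∨
         a ≡ 1 [ZMOD 64] ∧ b ≡ 31 [ZMOD 32] ∨
         a ≡ 9 [ZMOD 64] ∧ b ≡ 27 [ZMOD 32] ∨
         a ≡ 17 [ZMOD 64] ∧ b ≡ 7 [ZMOD 32] ∨
         a ≡ 25 [ZMOD 64] ∧ b ≡ 3 [ZMOD 32] ∨
         a ≡ 33 [ZMOD 64] ∧ b ≡ 15 [ZMOD 32] ∨
         a ≡ 41 [ZMOD 64] ∧ b ≡ 11 [ZMOD 32] ∨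
         a ≡ 49 [ZMOD 64] ∧ b ≡ 23 [ZMOD 32] ∨
         a ≡ 57 [ZMOD 64] ∧ b ≡ 19 [ZMOD 32])
    (h3 : a ≡ 0 [ZMOD 3] ∧ b ≡ 0 [ZMOD 27] ∨
         a ≡ 16 * 1 [ZMOD 9] ∧ (b ≡ 32 * 2 [ZMOD 27] ∨ b ≡ 32 * (-2) [ZMOD 27]) ∨
         a ≡ 16 * 4 [ZMOD 9] ∧ (b ≡ 32 * 16 [ZMOD 27] ∨ b ≡ 32 * (-16) [ZMOD 27]) ∨
         a ≡ 16 * 7 [ZMOD 9] ∧ (b ≡ 32 * 7 [ZMOD 27] ∨ b ≡ 32 * (-7) [ZMOD 27])) :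
    ∃ a1 a2 a3 a4 a6 : ℤ, wc4 a1 a2 a3 a4 = a ∧ wc6 a1 a2 a3 a4 a6 = b := by
  have key : ∀ a1 a2 a3 : ℤ,
      (∃ a4 a6 : ℤ, wc4 a1 a2 a3 a4 = a ∧ wc6 a1 a2 a3 a4 a6 = b) →
      ∃ a1 a2 a3 a4 a6 : ℤ, wc4 a1 a2 a3 a4 = a ∧ wc6 a1 a2 a3 a4 a6 = b :=
    fun a1 a2 a3 ⟨a4, a6, h⟩ => ⟨a1, a2, a3, a4, a6, h⟩
  have fin : ∀ a1 a2 a3 u v : ℤ, a1 ^ 2 + 4 * a2 = u → a3 ^ 2 = v →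
      u ^ 2 - 24 * (a1 * a3) - a = 48 * ((u ^ 2 - 24 * (a1 * a3) - a) / 48) →
      (-u ^ 3 + 36 * u * (a1 * a3 + 2 * ((u ^ 2 - 24 * (a1 * a3) - a) / 48)) - 216 * v - b) =
        864 * ((-u ^ 3 + 36 * u * (a1 * a3 + 2 * ((u ^ 2 - 24 * (a1 * a3) - a) / 48)) - 216 * v - b)
          / 864) →
      ∃ a4 a6 : ℤ, wc4 a1 a2 a3 a4 = a ∧ wc6 a1 a2 a3 a4 a6 = b := by
    intro a1 a2 a3 u v hu hv h4 h6
    refine ⟨?x, ?y, ?_, ?_⟩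
    · exact (u ^ 2 - 24 * (a1 * a3) - a) / 48
    · exact (-u ^ 3 + 36 * u * (a1 * a3 + 2 * ((u ^ 2 - 24 * (a1 * a3) - a) / 48)) - 216 * v - b)
          / 864
    · unfold wc4; rw [hu]; linarith
    · unfold wc6; rw [hu, hv]; linarith
  simp only [Int.ModEq] at h2 h3
  obtain ⟨s, hs, hs'⟩ : ∃ s : ℤ, (s = -1 ∨ s = 0 ∨ s = 1) ∧ (b + s) % 3 = 0 :=
    ⟨1 - (b + 1) % 3, by omega, by omega⟩
  rcases hs with rfl | rfl | rfl <;> rcases h2 with h2 | h2 | h2 | h2 | h2 | h2 | h2 | h2 | h2 | h2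
  all_goals
    first
    | exact key 0 (-1) 0 (fin 0 (-1) 0 (-4) 0 (by norm_num) (by norm_num) (by omega) (by omega))
    | exact key 0 0 0 (fin 0 0 0 0 0 (by norm_num) (by norm_num) (by omega) (by omega))
    | exact key 0 1 0 (fin 0 1 0 4 0 (by norm_num) (by norm_num) (by omega) (by omega))
    | exact key 0 (-1) 1 (fin 0 (-1) 1 (-4) 1 (by norm_num) (by norm_num) (by omega) (by omega))
    | exact key 0 0 1 (fin 0 0 1 0 1 (by norm_num) (by norm_num) (by omega) (by omega))
    | exact key 0 1 1 (fin 0 1 1 4 1 (by norm_num) (by norm_num) (by omega) (by omega))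
    | exact key 1 (-1) 0 (fin 1 (-1) 0 (-3) 0 (by norm_num) (by norm_num) (by omega) (by omega))
    | exact key 1 0 0 (fin 1 0 0 1 0 (by norm_num) (by norm_num) (by omega) (by omega))
    | exact key 1 1 0 (fin 1 1 0 5 0 (by norm_num) (by norm_num) (by omega) (by omega))
    | exact key 1 (-1) 1 (fin 1 (-1) 1 (-3) 1 (by norm_num) (by norm_num) (by omega) (by omega))
    | exact key 1 0 1 (fin 1 0 1 1 1 (by norm_num) (by norm_num) (by omega) (by omega))
    | exact key 1 1 1 (fin 1 1 1 5 1 (by norm_num) (by norm_num) (by omega) (by omega))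

theorem zmod_val_mod (n m : ℕ) [NeZero n] (hm : (m : ℤ) ∣ n) (y : ℤ) :
    (((y : ZMod n).val % m : ℕ) : ℤ) = y % m := by
  rw [Int.natCast_mod, ZMod.val_intCast, Int.emod_emod_of_dvd _ hm]

theorem kraus_conv_two (a1 a2 a3 a4 a6 a b : ℤ) (ha : wc4 a1 a2 a3 a4 = a)
    (hb : wc6 a1 a2 a3 a4 a6 = b) :
         a ≡ 0 [ZMOD 16] ∧ b ≡ 0 [ZMOD 32] ∨
         a ≡ 0 [ZMOD 16] ∧ b ≡ 8 [ZMOD 32] ∨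
         a ≡ 1 [ZMOD 64] ∧ b ≡ 31 [ZMOD 32] ∨
         a ≡ 9 [ZMOD 64] ∧ b ≡ 27 [ZMOD 32] ∨
         a ≡ 17 [ZMOD 64] ∧ b ≡ 7 [ZMOD 32] ∨
         a ≡ 25 [ZMOD 64] ∧ b ≡ 3 [ZMOD 32] ∨
         a ≡ 33 [ZMOD 64] ∧ b ≡ 15 [ZMOD 32] ∨
         a ≡ 41 [ZMOD 64] ∧ b ≡ 11 [ZMOD 32] ∨
         a ≡ 49 [ZMOD 64] ∧ b ≡ 23 [ZMOD 32] ∨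
         a ≡ 57 [ZMOD 64] ∧ b ≡ 19 [ZMOD 32] := by
  obtain ⟨d, hd⟩ := wc_rel a1 a2 a3 a4 a6
  rw [ha, hb] at hd
  rcases Int.even_or_odd' a1 with ⟨k, hk | hk⟩
  · -- `a₁` even
    have h1 : a = 16 * ((k ^ 2 + a2) ^ 2 - 3 * (k * a3 + a4)) := by
      rw [← ha, hk]; unfold wc4; ring
    rcases Int.even_or_odd' a3 with ⟨j, hj | hj⟩
    · have h2 : b = 32 * (-2 * (k ^ 2 + a2) ^ 3 + 9 * (k ^ 2 + a2) * (k * a3 + a4)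
          - 27 * (j ^ 2 + a6)) := by
        rw [← hb, hk, hj]; unfold wc6; ring
      left
      simp only [Int.ModEq]
      omega
    · have h2 : b = 32 * (-2 * (k ^ 2 + a2) ^ 3 + 9 * (k ^ 2 + a2) * (k * a3 + a4)
          - 27 * (j ^ 2 + j + a6) - 7) + 8 := by
        rw [← hb, hk, hj]; unfold wc6; ring
      right; left
      simp only [Int.ModEq]
      omega
  · -- `a₁` odd
    right; right
    have h1 : b = 4 * (-(3 * (k ^ 2 + k + a2) + 12 * (k ^ 2 + k + a2) ^ 2
          + 16 * (k ^ 2 + k + a2) ^ 3)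
          + 9 * (a1 ^ 2 + 4 * a2) * (a1 * a3 + 2 * a4) - 54 * (a3 ^ 2 + 4 * a6) - 1) + 3 := by
      rw [← hb, hk]; unfold wc6; ring
    have hz : (a : ZMod 64) ^ 3 = (b : ZMod 64) ^ 2 := by
      have := (ZMod.intCast_zmod_eq_zero_iff_dvd (a ^ 3 - b ^ 2) 64).2
        ⟨27 * d, by rw [hd]; push_cast; ring⟩
      push_cast at this
      exact sub_eq_zero.mp this
    have v4 := zmod_val_mod 64 4 (by norm_num) b
    have v32 := zmod_val_mod 64 32 (by norm_num) b
    push_cast at v4 v32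
    have h4 : b % 4 = 3 := by omega
    have e := two_odd (a : ZMod 64) (b : ZMod 64) hz (by omega)
    have c1 : ∀ r : ℤ, (a : ZMod 64) = (r : ZMod 64) → a ≡ r [ZMOD 64] := fun r h =>
      (ZMod.intCast_eq_intCast_iff a r 64).1 h
    have c2 : ∀ r : ℕ, r < 32 → (b : ZMod 64).val % 32 = r → b ≡ r [ZMOD 32] := by
      intro r hr h
      simp only [Int.ModEq]
      omega
    rcases e with h | h | h | h | h | h | h | h
    · exact Or.inl ⟨c1 1 (by exact_mod_cast h.1), c2 31 (by norm_num) h.2⟩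
    · exact Or.inr <| Or.inl ⟨c1 9 (by exact_mod_cast h.1), c2 27 (by norm_num) h.2⟩
    · exact Or.inr <| Or.inr <| Or.inl ⟨c1 17 (by exact_mod_cast h.1), c2 7 (by norm_num) h.2⟩
    · exact Or.inr <| Or.inr <| Or.inr <| Or.inl
        ⟨c1 25 (by exact_mod_cast h.1), c2 3 (by norm_num) h.2⟩
    · exact Or.inr <| Or.inr <| Or.inr <| Or.inr <| Or.inl
        ⟨c1 33 (by exact_mod_cast h.1), c2 15 (by norm_num) h.2⟩
    · exact Or.inr <| Or.inr <| Or.inr <| Or.inr <| Or.inr <| Or.inl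
        ⟨c1 41 (by exact_mod_cast h.1), c2 11 (by norm_num) h.2⟩
    · exact Or.inr <| Or.inr <| Or.inr <| Or.inr <| Or.inr <| Or.inr <| Or.inl
        ⟨c1 49 (by exact_mod_cast h.1), c2 23 (by norm_num) h.2⟩
    · exact Or.inr <| Or.inr <| Or.inr <| Or.inr <| Or.inr <| Or.inr <| Or.inr
        ⟨c1 57 (by exact_mod_cast h.1), c2 19 (by norm_num) h.2⟩

theorem kraus_conv_three (a1 a2 a3 a4 a6 a b : ℤ) (ha : wc4 a1 a2 a3 a4 = a)
    (hb : wc6 a1 a2 a3 a4 a6 = b) :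
         a ≡ 0 [ZMOD 3] ∧ b ≡ 0 [ZMOD 27] ∨
         a ≡ 16 * 1 [ZMOD 9] ∧ (b ≡ 32 * 2 [ZMOD 27] ∨ b ≡ 32 * (-2) [ZMOD 27]) ∨
         a ≡ 16 * 4 [ZMOD 9] ∧ (b ≡ 32 * 16 [ZMOD 27] ∨ b ≡ 32 * (-16) [ZMOD 27]) ∨
         a ≡ 16 * 7 [ZMOD 9] ∧ (b ≡ 32 * 7 [ZMOD 27] ∨ b ≡ 32 * (-7) [ZMOD 27]) := by
  obtain ⟨d, hd⟩ := wc_rel a1 a2 a3 a4 a6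
  rw [ha, hb] at hd
  by_cases h3 : (3 : ℤ) ∣ a
  · left
    have hb2 : (3 : ℤ) ∣ (a1 ^ 2 + 4 * a2) := by
      have : (3 : ℤ) ∣ (a1 ^ 2 + 4 * a2) ^ 2 := by
        have h : (a1 ^ 2 + 4 * a2) ^ 2 = a + 3 * (8 * (a1 * a3 + 2 * a4)) := by
          rw [← ha]; unfold wc4; ring
        rw [h]
        exact dvd_add h3 (dvd_mul_right _ _)
      exact Int.prime_three.dvd_of_dvd_pow this
    obtain ⟨t, ht⟩ := hb2
    have h6 : b = 27 * (-t ^ 3 + 4 * t * (a1 * a3 + 2 * a4) - 8 * (a3 ^ 2 + 4 * a6)) := by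
      rw [← hb]; unfold wc6; rw [ht]; ring
    simp only [Int.ModEq]
    omega
  · right
    have hz : (a : ZMod 27) ^ 3 = (b : ZMod 27) ^ 2 := by
      have := (ZMod.intCast_zmod_eq_zero_iff_dvd (a ^ 3 - b ^ 2) 27).2
        ⟨64 * d, by rw [hd]; push_cast; ring⟩
      push_cast at this
      exact sub_eq_zero.mp this
    have v3 := zmod_val_mod 27 3 (by norm_num) a
    have v9 := zmod_val_mod 27 9 (by norm_num) a
    push_cast at v3 v9
    have e := three_unit (a : ZMod 27) (b : ZMod 27) hz (by omega)
    have v27 := zmod_val_mod 27 27 (by norm_num) b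
    have hlt := ZMod.val_lt (b : ZMod 27)
    push_cast at v27
    simp only [Int.ModEq]
    rcases e with ⟨h, h' | h'⟩ | ⟨h, h' | h'⟩ | ⟨h, h' | h'⟩
    · omega
    · omega
    · omega
    · omega
    · omega
    · omega

/-- A pair `(I₀, J₀) ∈ ℚ × ℚ` occurs as the invariants of an integral ternary cubic form
if and only if `16I₀, 32J₀ ∈ ℤ`, the pair `(16I₀, 32J₀)` satisfies one of the listed
congruence conditions modulo 64/32, and `(I₀, J₀)` satisfies one of the listed congruence
conditions modulo 27 (interpreted via the integers `16I₀` and `32J₀`). -/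
theorem stmt11 (P Q : MvPolynomial (Fin 10) ℚ) (hPQ : IsInvariantPair ℚ P Q)
    (I₀ J₀ : ℚ) :
    Eligible P Q I₀ J₀ ↔
      ∃ a b : ℤ, 16 * I₀ = (a : ℚ) ∧ 32 * J₀ = (b : ℚ) ∧
        (a ≡ 0 [ZMOD 16] ∧ b ≡ 0 [ZMOD 32] ∨
         a ≡ 0 [ZMOD 16] ∧ b ≡ 8 [ZMOD 32] ∨
         a ≡ 1 [ZMOD 64] ∧ b ≡ 31 [ZMOD 32] ∨
         a ≡ 9 [ZMOD 64] ∧ b ≡ 27 [ZMOD 32] ∨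
         a ≡ 17 [ZMOD 64] ∧ b ≡ 7 [ZMOD 32] ∨
         a ≡ 25 [ZMOD 64] ∧ b ≡ 3 [ZMOD 32] ∨
         a ≡ 33 [ZMOD 64] ∧ b ≡ 15 [ZMOD 32] ∨
         a ≡ 41 [ZMOD 64] ∧ b ≡ 11 [ZMOD 32] ∨
         a ≡ 49 [ZMOD 64] ∧ b ≡ 23 [ZMOD 32] ∨
         a ≡ 57 [ZMOD 64] ∧ b ≡ 19 [ZMOD 32]) ∧
        (a ≡ 0 [ZMOD 3] ∧ b ≡ 0 [ZMOD 27] ∨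
         a ≡ 16 * 1 [ZMOD 9] ∧ (b ≡ 32 * 2 [ZMOD 27] ∨ b ≡ 32 * (-2) [ZMOD 27]) ∨
         a ≡ 16 * 4 [ZMOD 9] ∧ (b ≡ 32 * 16 [ZMOD 27] ∨ b ≡ 32 * (-16) [ZMOD 27]) ∨
         a ≡ 16 * 7 [ZMOD 9] ∧ (b ≡ 32 * 7 [ZMOD 27] ∨ b ≡ 32 * (-7) [ZMOD 27])) := by
  constructor
  · rintro ⟨c, hI, hJ⟩
    obtain ⟨h4, h6⟩ := invariants_eval P Q hPQ c
    rw [hI] at h4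
    rw [hJ] at h6
    exact ⟨cub4 c, cub6 c, h4, h6,
      kraus_conv_two (jac_a1 c) (jac_a2 c) (jac_a3 c) (jac_a4 c) (jac_a6 c) _ _ rfl rfl,
      kraus_conv_three (jac_a1 c) (jac_a2 c) (jac_a3 c) (jac_a4 c) (jac_a6 c) _ _ rfl rfl⟩
  · rintro ⟨a, b, hI, hJ, h2, h3⟩
    obtain ⟨a1, a2, a3, a4, a6, ha, hb⟩ := kraus a b h2 h3
    obtain ⟨c, h4, h6⟩ := exists_cubic a1 a2 a3 a4 a6
    obtain ⟨e4, e6⟩ := invariants_eval P Q hPQ c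
    rw [h4, ha, ← hI] at e4
    rw [h6, hb, ← hJ] at e6
    exact ⟨c, by linarith, by linarith⟩
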